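/- Let q̃_1, …, q̃_{r−1} be pairwise distinct integers such that each q̃_i ≡ 1 (mod 4) and each |q̃_i| is an odd prime, and let q̃_r = −4. In ℂ set α_i = (1 + √q̃_i)/2 and ᾱ_i = (1 − √q̃_i)/2 for i < r, and α_r = √(q̃_r/4) = i. Let M = ℚ(√q̃_1, …, √q̃_{r−1}, i) ⊂ ℂ. Then: (1) the 2^r products α_1^{s_1}⋯α_r^{s_r}, for s ∈ {0,1}^r, form a ℤ-basis of the ring of integers 𝓞_M; (2) the 2^r products ᾱ_1^{s_1}·α_1^{1−s_1}⋯ᾱ_{r−1}^{s_{r−1}}·α_{r−1}^{1−s_{r−1}}·α_r^{s_r}, for s ∈ {0,1}^r, also form a ℤ-basis of 𝓞_M. -/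

import Mathlib

/-- The square root of a real number inside `ℂ`: for a negative real `x`,
`√x` denotes `i·√|x|`. -/
noncomputable def csqrt (x : ℝ) : ℂ :=
  if x < 0 then Complex.I * Real.sqrt (-x) else Real.sqrt x

/-- A family `e` of complex numbers is a `ℤ`-basis of the ring of integers
`𝓞_M = integralClosure ℤ M` of a subfield `M ⊂ ℂ`. -/
def IsIntBasis {ι : Type*} (M : IntermediateField ℚ ℂ) (e : ι → ℂ) : Prop :=
  (∀ s, e s ∈ M) ∧ (∀ s, IsIntegral ℤ (e s)) ∧ LinearIndependent ℤ e ∧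
    ∀ x : ℂ, x ∈ M → IsIntegral ℤ x → x ∈ Submodule.span ℤ (Set.range e)

theorem csqrt_sq (x : ℝ) : csqrt x ^ 2 = (x : ℂ) := by
  unfold csqrt
  split_ifs with h
  · rw [mul_pow, Complex.I_sq, ← Complex.ofReal_pow, Real.sq_sqrt (by linarith)]
    push_cast; ring
  · rw [← Complex.ofReal_pow, Real.sq_sqrt (by linarith)]

theorem csqrt_intCast_sq (q : ℤ) : csqrt (q : ℝ) ^ 2 = (q : ℂ) := by
  rw [csqrt_sq]; push_cast; rfl

theorem IsIntegral.of_eq {R A : Type*} [CommRing R] [Ring A] [Algebra R A] {x y : A}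
    (h : IsIntegral R x) (e : y = x) : IsIntegral R y :=
  e ▸ h

theorem Int.cast_eq_sign_mul_natAbs {R : Type*} [Ring R] (q : ℤ) :
    (q : R) = q.sign * q.natAbs := by
  rw [← Int.cast_natCast (R := R) q.natAbs, ← Int.cast_mul, Int.sign_mul_natAbs]

theorem isIntegral_of_sq_eq_intCast {s : ℂ} {q : ℤ} (hs : s ^ 2 = q) : IsIntegral ℤ s :=
  IsIntegral.of_pow two_pos (hs ▸ isIntegral_intCast q)

/-- The rational numbers integral over `ℤ` are the integers. -/
theorem exists_intCast_eq_of_mem_bot {x : ℂ} (hx : x ∈ (⊥ : IntermediateField ℚ ℂ))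
    (hi : IsIntegral ℤ x) : ∃ n : ℤ, x = n := by
  obtain ⟨y, rfl⟩ := IntermediateField.mem_bot.1 hx
  have hy : IsIntegral ℤ y := (isIntegral_algebraMap_iff (algebraMap ℚ ℂ).injective).1 hi
  obtain ⟨n, rfl⟩ := IsIntegrallyClosed.isIntegral_iff.1 hy
  exact ⟨n, by simp⟩

/-- Membership in `K'` means being of the form `u + v s` with `u, v ∈ K`, where `s ∉ K`
is a square root of the integer `q`. -/
structure IsQuadExt (K K' : IntermediateField ℚ ℂ) (s : ℂ) (q : ℤ) : Prop where
  sq : s ^ 2 = q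
  notMem : s ∉ K
  le : K ≤ K'
  mem : s ∈ K'
  exists_eq : ∀ x ∈ K', ∃ u ∈ K, ∃ v ∈ K, x = u + v * s

theorem isQuadExt_adjoin_insert {S : Set ℂ} {s : ℂ} {q : ℤ} (hs : s ^ 2 = q)
    (hn : s ∉ IntermediateField.adjoin ℚ S) :
    IsQuadExt (IntermediateField.adjoin ℚ S) (IntermediateField.adjoin ℚ (insert s S)) s q where
  sq := hs
  notMem := hn
  le := IntermediateField.adjoin.mono ℚ _ _ (Set.subset_insert _ _)
  mem := IntermediateField.subset_adjoin ℚ _ (Set.mem_insert _ _)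
  exists_eq x hx := by
    set K := IntermediateField.adjoin ℚ S
    have hq : (q : ℂ) ∈ K := intCast_mem K q
    induction hx using IntermediateField.adjoin_induction with
    | mem x hx =>
      rcases hx with rfl | hx
      · exact ⟨0, zero_mem K, 1, one_mem K, by ring⟩
      · exact ⟨x, IntermediateField.subset_adjoin ℚ _ hx, 0, zero_mem K, by ring⟩
    | algebraMap x => exact ⟨_, K.algebraMap_mem x, 0, zero_mem K, by ring⟩
    | add x y _ _ hx hy =>
      obtain ⟨u, hu, v, hv, rfl⟩ := hx
      obtain ⟨u', hu', v', hv', rfl⟩ := hy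
      exact ⟨u + u', add_mem hu hu', v + v', add_mem hv hv', by ring⟩
    | mul x y _ _ hx hy =>
      obtain ⟨u, hu, v, hv, rfl⟩ := hx
      obtain ⟨u', hu', v', hv', rfl⟩ := hy
      exact ⟨u * u' + v * v' * q, add_mem (mul_mem hu hu') (mul_mem (mul_mem hv hv') hq),
        u * v' + v * u', add_mem (mul_mem hu hv') (mul_mem hv hu'), by rw [← hs]; ring⟩
    | inv x _ hx =>
      obtain ⟨u, hu, v, hv, rfl⟩ := hx
      by_cases hN : u ^ 2 - v ^ 2 * q = 0
      · have hv0 : v = 0 := by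
          by_contra hv0
          have h2 : (u / v) ^ 2 = s ^ 2 := by
            rw [hs]; field_simp; linear_combination hN
          rcases sq_eq_sq_iff_eq_or_eq_neg.1 h2 with h | h
          · exact hn (h ▸ div_mem hu hv)
          · exact hn (by rw [← neg_neg s, ← h]; exact neg_mem (div_mem hu hv))
        subst hv0
        exact ⟨u⁻¹, inv_mem hu, 0, zero_mem K, by simp⟩
      · have hN' : u ^ 2 - v ^ 2 * q ∈ K :=
          sub_mem (pow_mem hu 2) (mul_mem (pow_mem hv 2) hq)
        refine ⟨u / (u ^ 2 - v ^ 2 * q), div_mem hu hN', -v / (u ^ 2 - v ^ 2 * q),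
          div_mem (neg_mem hv) hN', inv_eq_of_mul_eq_one_right ?_⟩
        field_simp
        rw [← hs]; ring

namespace IsQuadExt

variable {K K' : IntermediateField ℚ ℂ} {s : ℂ} {q : ℤ}

theorem eq_zero_of_add_mul_eq_zero (h : IsQuadExt K K' s q) {u v : ℂ} (hu : u ∈ K) (hv : v ∈ K)
    (h0 : u + v * s = 0) : u = 0 ∧ v = 0 := by
  have hv0 : v = 0 := by
    by_contra hv0
    refine h.notMem ?_
    have : s = -u / v := by field_simp; linear_combination h0
    exact this ▸ div_mem (neg_mem hu) hv
  subst hv0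
  exact ⟨by simpa using h0, rfl⟩

/-- The conjugate `u - v s` of an algebraic integer `u + v s` is an algebraic integer. -/
theorem isIntegral_conj (h : IsQuadExt K K' s q) {u v : ℂ} (hu : u ∈ K) (hv : v ∈ K)
    (hi : IsIntegral ℤ (u + v * s)) : IsIntegral ℤ (u - v * s) := by
  have key : ∀ P : Polynomial ℤ, ∃ A ∈ K, ∃ B ∈ K,
      Polynomial.aeval (u + v * s) P = A + B * s ∧
      Polynomial.aeval (u - v * s) P = A - B * s := by
    intro P
    induction P using Polynomial.induction_on' with
    | add f g hf hg =>
      obtain ⟨A, hA, B, hB, h1, h2⟩ := hf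
      obtain ⟨A', hA', B', hB', h1', h2'⟩ := hg
      exact ⟨A + A', add_mem hA hA', B + B', add_mem hB hB',
        by rw [map_add, h1, h1']; ring, by rw [map_add, h2, h2']; ring⟩
    | monomial n c =>
      induction n with
      | zero => exact ⟨c, intCast_mem K c, 0, zero_mem K, by simp, by simp⟩
      | succ n ih =>
        obtain ⟨A, hA, B, hB, h1, h2⟩ := ih
        refine ⟨A * u + B * v * q, add_mem (mul_mem hA hu)
          (mul_mem (mul_mem hB hv) (intCast_mem K q)), A * v + B * u,
          add_mem (mul_mem hA hv) (mul_mem hB hu), ?_, ?_⟩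
        · rw [← Polynomial.monomial_mul_X, map_mul, h1, Polynomial.aeval_X, ← h.sq]; ring
        · rw [← Polynomial.monomial_mul_X, map_mul, h2, Polynomial.aeval_X, ← h.sq]; ring
  obtain ⟨P, hP, hP0⟩ := hi
  obtain ⟨A, hA, B, hB, h1, h2⟩ := key P
  rw [← Polynomial.aeval_def, h1] at hP0
  obtain ⟨rfl, rfl⟩ := h.eq_zero_of_add_mul_eq_zero hA hB hP0
  exact ⟨P, hP, by rw [← Polynomial.aeval_def, h2]; simp⟩

end IsQuadExt

/-- The ring of integers of `K` is reduced modulo `p`. -/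
def ReducedMod (K : IntermediateField ℚ ℂ) (p : ℕ) : Prop :=
  ∀ w ∈ K, IsIntegral ℤ w → IsIntegral ℤ (w ^ 2 / p) → IsIntegral ℤ (w / p)

theorem exists_intCast_eq_of_mul_eq {x : ℂ} {p m : ℤ} (hp : p ≠ 0) (hx : IsIntegral ℤ x)
    (h : x * p = m) : ∃ n : ℤ, x = n := by
  refine exists_intCast_eq_of_mem_bot ?_ hx
  have hp' : (p : ℂ) ≠ 0 := by exact_mod_cast hp
  rw [← eq_div_iff hp'] at h
  exact h ▸ div_mem (intCast_mem _ _) (intCast_mem _ _)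

theorem reducedMod_bot {p : ℕ} (hp : p.Prime) : ReducedMod ⊥ p := by
  intro w hw hi h2
  obtain ⟨m, rfl⟩ := exists_intCast_eq_of_mem_bot hw hi
  have hp0 : (p : ℂ) ≠ 0 := by exact_mod_cast hp.ne_zero
  obtain ⟨n, hn⟩ := exists_intCast_eq_of_mul_eq (p := p) (m := m ^ 2)
    (by exact_mod_cast hp.ne_zero) h2 (by push_cast; field_simp)
  rw [div_eq_iff hp0] at hn
  have hd : (p : ℤ) ∣ m ^ 2 := ⟨n, by rw [mul_comm]; exact_mod_cast hn⟩
  obtain ⟨k, rfl⟩ := (Nat.prime_iff_prime_int.1 hp).dvd_of_dvd_pow hd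
  have : ((p * k : ℤ) : ℂ) / p = k := by push_cast; field_simp
  exact this ▸ isIntegral_intCast k

theorem isIntegral_div_of_isCoprime {x : ℂ} {m : ℤ} {p : ℕ} (hp : p ≠ 0) (hc : IsCoprime m p)
    (hx : IsIntegral ℤ x) (h : IsIntegral ℤ (m * x / p)) : IsIntegral ℤ (x / p) := by
  obtain ⟨a, b, hab⟩ := hc
  have hp0 : (p : ℂ) ≠ 0 := by exact_mod_cast hp
  have hab' : (a * m + b * p : ℂ) = 1 := by exact_mod_cast hab
  have : x / p = a * (m * x / p) + b * x := by
    field_simp; linear_combination (-x) * hab'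
  rw [this]
  exact ((isIntegral_intCast a).mul h).add ((isIntegral_intCast b).mul hx)

theorem ReducedMod.notMem {K : IntermediateField ℚ ℂ} {s : ℂ} {q : ℤ} (hs : s ^ 2 = q)
    (hq : q.natAbs.Prime) (hK : ReducedMod K q.natAbs) : s ∉ K := by
  intro hsK
  have hq0 : (q : ℂ) ≠ 0 := by exact_mod_cast Int.natAbs_ne_zero.1 hq.ne_zero
  have hp0 : (q.natAbs : ℂ) ≠ 0 := by exact_mod_cast hq.ne_zero
  have hpq : (q.natAbs : ℂ) ^ 2 = (q : ℂ) ^ 2 := by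
    have := congrArg (Int.cast : ℤ → ℂ) (Int.natAbs_sq q)
    rwa [Int.cast_pow, Int.cast_pow, Int.cast_natCast] at this
  have hint : IsIntegral ℤ (s ^ 2 / (q.natAbs : ℂ)) := by
    have : s ^ 2 / (q.natAbs : ℂ) = q.sign := by
      rw [hs, div_eq_iff hp0]; exact Int.cast_eq_sign_mul_natAbs q
    exact this ▸ isIntegral_intCast _
  have h := (hK s hsK (isIntegral_of_sq_eq_intCast hs) hint).pow 2
  rw [div_pow, hs, hpq] at h
  obtain ⟨n, hn⟩ := exists_intCast_eq_of_mul_eq (p := q) (m := 1)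
    (by exact_mod_cast hq0) h (by push_cast; field_simp)
  rw [div_eq_iff (pow_ne_zero 2 hq0)] at hn
  have h1 : q * (n * q - 1) = 0 := by
    have : (q : ℂ) * (n * q - 1) = 0 := by linear_combination -hn
    exact_mod_cast this
  have h2 : n * q = 1 := by
    rcases mul_eq_zero.1 h1 with h1 | h1
    · exact absurd h1 (by exact_mod_cast hq0)
    · omega
  exact hq.one_lt.ne' (Int.isUnit_iff_natAbs_eq.1 (.of_mul_eq_one n (mul_comm n q ▸ h2)))

theorem IsQuadExt.reducedMod {K K' : IntermediateField ℚ ℂ} {s : ℂ} {q : ℤ}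
    (h : IsQuadExt K K' s q) {p : ℕ} (hp : p.Prime) (h2 : IsCoprime 2 (p : ℤ))
    (hq : IsCoprime q p) (hK : ReducedMod K p) : ReducedMod K' p := by
  intro w hw hi hsq
  obtain ⟨u, hu, v, hv, rfl⟩ := h.exists_eq w hw
  have hp0 : (p : ℂ) ≠ 0 := by exact_mod_cast hp.ne_zero
  have hpK : (p : ℂ) ∈ K := natCast_mem K p
  have hqK : (q : ℂ) ∈ K := intCast_mem K q
  have hTK : ∀ c ∈ K, 2 * c ∈ K := fun c hc => by rw [two_mul]; exact add_mem hc hc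
  have hs : IsIntegral ℤ s := isIntegral_of_sq_eq_intCast h.sq
  have hpi : IsIntegral ℤ (p : ℂ) := by simpa using isIntegral_intCast p
  have h2i : IsIntegral ℤ (2 : ℂ) := by simpa using isIntegral_intCast 2
  have hi' := h.isIntegral_conj hu hv hi
  have hsq' : IsIntegral ℤ ((u - v * s) ^ 2 / p) := by
    have := h.isIntegral_conj (u := (u ^ 2 + v ^ 2 * q) / p) (v := 2 * (u * v) / p)
      (div_mem (add_mem (pow_mem hu 2) (mul_mem (pow_mem hv 2) hqK)) hpK)
      (div_mem (hTK _ (mul_mem hu hv)) hpK)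
      (by refine .of_eq hsq ?_; rw [← h.sq]; field_simp; ring)
    refine .of_eq this ?_; rw [← h.sq]; field_simp; ring
  have hN : IsIntegral ℤ ((u + v * s) * (u - v * s) / p) := by
    refine hK _ ?_ (hi.mul hi') ?_
    · have : (u + v * s) * (u - v * s) = u ^ 2 - v ^ 2 * q := by rw [← h.sq]; ring
      exact this ▸ sub_mem (pow_mem hu 2) (mul_mem (pow_mem hv 2) hqK)
    · refine .of_eq ((hpi.mul hsq).mul hsq') ?_; field_simp
  have hT : IsIntegral ℤ (2 * u / p) := by
    refine hK _ (hTK u hu) ?_ ?_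
    · refine .of_eq (hi.add hi') ?_; ring
    · refine .of_eq ((hsq.add hsq').add (h2i.mul hN)) ?_; field_simp; ring
  have hDi : IsIntegral ℤ (2 * (v * s)) := by
    refine .of_eq (hi.sub hi') ?_; ring
  have hD2 : IsIntegral ℤ ((2 * (v * s)) ^ 2 / p) := by
    refine .of_eq ((hsq.add hsq').sub (h2i.mul hN)) ?_; field_simp; ring
  have hV : IsIntegral ℤ (2 * (v * q) / p) := by
    refine hK _ (hTK _ (mul_mem hv hqK)) ?_ ?_
    · refine .of_eq (hDi.mul hs) ?_; rw [← h.sq]; ring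
    · refine .of_eq (hD2.mul (isIntegral_intCast q)) ?_; rw [← h.sq]; field_simp
  have hD : IsIntegral ℤ (2 * (v * s) / p) := by
    refine isIntegral_div_of_isCoprime hp.ne_zero hq hDi ?_
    refine .of_eq (hV.mul hs) ?_; field_simp
  refine isIntegral_div_of_isCoprime hp.ne_zero h2 hi ?_
  refine .of_eq (hT.add hD) ?_; push_cast; ring

/-- A relative integral basis `f` of `K' / K` and an integral basis `g` of `K` multiply to an
integral basis of `K'`. -/
theorem IsIntBasis.mul {K K' : IntermediateField ℚ ℂ} (hle : K ≤ K') {n : ℕ}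
    {g : (Fin n → Fin 2) → ℂ} (hg : IsIntBasis K g) {f : Fin 2 → ℂ} (hfm : ∀ i, f i ∈ K')
    (hfi : ∀ i, IsIntegral ℤ (f i))
    (hfl : ∀ u ∈ K, ∀ v ∈ K, u * f 0 + v * f 1 = 0 → u = 0 ∧ v = 0)
    (hfs : ∀ x ∈ K', IsIntegral ℤ x → ∃ u ∈ K, ∃ v ∈ K, IsIntegral ℤ u ∧ IsIntegral ℤ v ∧
      x = u * f 0 + v * f 1) :
    IsIntBasis K' fun t : Fin (n + 1) → Fin 2 => f (t 0) * g (Fin.tail t) := by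
  obtain ⟨hgm, hgi, hgl, hgs⟩ := hg
  refine ⟨fun t => mul_mem (hfm _) (hle (hgm _)), fun t => (hfi _).mul (hgi _), ?_, ?_⟩
  · rw [Fintype.linearIndependent_iff] at hgl ⊢
    intro c hc
    rw [← (Fin.consEquiv fun _ => Fin 2).sum_comp, Fintype.sum_prod_type, Fin.sum_univ_two] at hc
    have hm : ∀ i, ∑ t, c (Fin.cons i t) • g t ∈ K :=
      fun i => sum_mem fun t _ => zsmul_mem (hgm t) _
    obtain ⟨h0, h1⟩ := hfl _ (hm 0) _ (hm 1) (by
      rw [← hc, Finset.sum_mul, Finset.sum_mul]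
      congr 1 <;>
        exact Finset.sum_congr rfl fun t _ => by
          simp [Fin.consEquiv]
          ring)
    intro t
    have h : ∀ i, ∑ t, c (Fin.cons i t) • g t = 0 := Fin.forall_fin_two.2 ⟨h0, h1⟩
    have := hgl _ (h (t 0)) (Fin.tail t)
    rwa [Fin.cons_self_tail] at this
  · intro x hx hi
    obtain ⟨u, hu, v, hv, hui, hvi, rfl⟩ := hfs x hx hi
    have key : ∀ i, ∀ y ∈ Submodule.span ℤ (Set.range g), y * f i ∈
        Submodule.span ℤ (Set.range fun t : Fin (n + 1) → Fin 2 => f (t 0) * g (Fin.tail t)) := by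
      intro i y hy
      induction hy using Submodule.span_induction with
      | mem y hy =>
        obtain ⟨t, rfl⟩ := hy
        exact Submodule.subset_span ⟨Fin.cons i t, by simp [mul_comm]⟩
      | zero => simp
      | add y z _ _ hy hz => rw [add_mul]; exact add_mem hy hz
      | smul a y _ hy => rw [smul_mul_assoc]; exact Submodule.smul_mem _ a hy
    exact add_mem (key 0 u (hgs u hu hui)) (key 1 v (hgs v hv hvi))

theorem isIntBasis_bot : IsIntBasis ⊥ fun _ : Fin 0 → Fin 2 => (1 : ℂ) := by
  refine ⟨fun _ => one_mem _, fun _ => isIntegral_one, ?_, fun x hx hi => ?_⟩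
  · rw [Fintype.linearIndependent_iff]
    intro c hc t
    rw [Fintype.sum_unique] at hc
    rw [Subsingleton.elim t (@default _ Unique.instInhabited)]
    simpa only [zsmul_eq_mul, mul_one, Int.cast_eq_zero] using hc
  · obtain ⟨n, rfl⟩ := exists_intCast_eq_of_mem_bot hx hi
    have := Submodule.smul_mem (Submodule.span ℤ (Set.range fun _ : Fin 0 → Fin 2 => (1 : ℂ))) n
      (Submodule.subset_span ⟨default, rfl⟩)
    simpa using this

theorem isQuadExt_I :
    IsQuadExt ⊥ (IntermediateField.adjoin ℚ {Complex.I}) Complex.I (-1) := by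
  have hn : Complex.I ∉ IntermediateField.adjoin ℚ (∅ : Set ℂ) := by
    rw [IntermediateField.adjoin_empty, IntermediateField.mem_bot]
    rintro ⟨x, hx⟩
    simpa using congrArg Complex.im hx
  simpa using isQuadExt_adjoin_insert (q := -1) (by simp) hn

theorem isIntBasis_adjoin_I : IsIntBasis (IntermediateField.adjoin ℚ {Complex.I})
    fun t : Fin 1 → Fin 2 => Complex.I ^ (t 0 : ℕ) := by
  have h := isQuadExt_I
  have hI : IsIntegral ℤ Complex.I := isIntegral_of_sq_eq_intCast h.sq
  have := isIntBasis_bot.mul h.le (f := fun i => Complex.I ^ (i : ℕ)) (fun i => pow_mem h.mem _)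
    (fun i => hI.pow _) (fun u hu v hv h0 => h.eq_zero_of_add_mul_eq_zero hu hv (by simpa using h0))
    (fun x hx hi => ?_)
  · simpa using this
  obtain ⟨u, hu, v, hv, rfl⟩ := h.exists_eq x hx
  have hi' := h.isIntegral_conj hu hv hi
  have hN : u ^ 2 + v ^ 2 ∈ (⊥ : IntermediateField ℚ ℂ) :=
    add_mem (pow_mem hu 2) (pow_mem hv 2)
  obtain ⟨a, ha⟩ := exists_intCast_eq_of_mem_bot (add_mem hu hu)
    (by refine .of_eq (hi.add hi') ?_; ring)
  obtain ⟨b, hb⟩ := exists_intCast_eq_of_mem_bot (add_mem hv hv)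
    (by refine .of_eq ((hi'.sub hi).mul hI) ?_; linear_combination (2 * v) * Complex.I_sq)
  obtain ⟨c, hc⟩ := exists_intCast_eq_of_mem_bot hN
    (by refine .of_eq (hi.mul hi') ?_; linear_combination v ^ 2 * Complex.I_sq)
  have habc : a ^ 2 + b ^ 2 = 4 * c := by
    have : (a : ℂ) ^ 2 + b ^ 2 = 4 * c := by rw [← ha, ← hb, ← hc]; ring
    exact_mod_cast this
  have heven : Even a ∧ Even b := by
    rcases Int.even_or_odd' a with ⟨k, rfl | rfl⟩ <;> rcases Int.even_or_odd' b with ⟨l, rfl | rfl⟩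
    · exact ⟨even_two_mul k, even_two_mul l⟩
    all_goals ring_nf at habc; omega
  obtain ⟨⟨k, rfl⟩, ⟨l, rfl⟩⟩ := heven
  have hk : u = k := by push_cast at ha; linear_combination ha / 2
  have hl : v = l := by push_cast at hb; linear_combination hb / 2
  exact ⟨u, hu, v, hv, hk ▸ isIntegral_intCast k, hl ▸ isIntegral_intCast l, by simp⟩

theorem isIntegral_half_one_add {s : ℂ} {q : ℤ} (hs : s ^ 2 = q) (hq : q % 4 = 1) :
    IsIntegral ℤ ((1 + s) / 2) := by
  obtain ⟨k, rfl⟩ : ∃ k, q = 4 * k + 1 := ⟨q / 4, by omega⟩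
  refine ⟨Polynomial.X ^ 2 - Polynomial.X - Polynomial.C k, by monicity!, ?_⟩
  rw [← Polynomial.aeval_def]
  push_cast at hs
  simp
  linear_combination hs / 4

theorem IsQuadExt.exists_eq_add_mul_half {K K' : IntermediateField ℚ ℂ} {s : ℂ} {q : ℤ}
    (h : IsQuadExt K K' s q) (hq : q.natAbs.Prime) (hq4 : q % 4 = 1)
    (hK : ReducedMod K q.natAbs) {x : ℂ} (hx : x ∈ K') (hi : IsIntegral ℤ x) :
    ∃ u ∈ K, ∃ v ∈ K, IsIntegral ℤ u ∧ IsIntegral ℤ v ∧ x = u + v * ((1 + s) / 2) := by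
  obtain ⟨u, hu, v, hv, rfl⟩ := h.exists_eq x hx
  have hi' := h.isIntegral_conj hu hv hi
  have hs : IsIntegral ℤ s := isIntegral_of_sq_eq_intCast h.sq
  have hp0 : (q.natAbs : ℂ) ≠ 0 := by exact_mod_cast hq.ne_zero
  have hsign : (q : ℂ) = q.sign * q.natAbs := Int.cast_eq_sign_mul_natAbs q
  have hsign2 : (q.sign : ℂ) * q.sign = 1 := by
    have : q.sign * q.sign = 1 := by
      rw [← Int.sign_mul]
      exact Int.sign_eq_one_of_pos (mul_self_pos.2 (Int.natAbs_ne_zero.1 hq.ne_zero))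
    exact_mod_cast this
  have hDi : IsIntegral ℤ (2 * (v * s)) := by
    refine .of_eq (hi.sub hi') ?_; ring
  have hv2K : v + v ∈ K := add_mem hv hv
  have hV := hK ((v + v) * q) (mul_mem hv2K (intCast_mem K q))
    (by refine .of_eq (hDi.mul hs) ?_; rw [← h.sq]; ring)
    (by
      refine .of_eq ((hDi.pow 2).mul (isIntegral_intCast q.sign)) ?_
      rw [mul_pow, mul_pow, mul_pow, h.sq, div_eq_iff hp0]
      linear_combination (4 * v ^ 2 * q) * hsign)
  have hv2 : IsIntegral ℤ (v + v) := by
    refine .of_eq (hV.mul (isIntegral_intCast q.sign)) ?_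
    rw [eq_comm, div_mul_eq_mul_div, div_eq_iff hp0]
    linear_combination ((v + v) * q.sign) * hsign + ((v + v) * q.natAbs) * hsign2
  refine ⟨u - v, sub_mem hu hv, v + v, hv2K, ?_, hv2, by ring⟩
  refine .of_eq (hi.sub (hv2.mul (isIntegral_half_one_add h.sq hq4))) ?_
  ring

theorem isCoprime_of_prime_ne {q : ℤ} {p : ℕ} (hq : q.natAbs.Prime) (hp : p.Prime)
    (hne : q.natAbs ≠ p) : IsCoprime q p := by
  rw [Int.isCoprime_iff_gcd_eq_one, Int.gcd_eq_natAbs, Int.natAbs_natCast]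
  exact (Nat.coprime_primes hq hp).2 hne

theorem range_union_eq_insert {n : ℕ} (σ : Fin (n + 1) → ℂ) (T : Set ℂ) :
    Set.range σ ∪ T = insert (σ 0) (Set.range (Fin.tail σ) ∪ T) := by
  rw [← Set.insert_union]
  congr 1
  conv_lhs => rw [← Fin.cons_self_tail σ, Fin.range_cons]

theorem reducedMod_and_isIntBasis (n : ℕ) (q : Fin n → ℤ) (σ : Fin n → ℂ)
    (hσ : ∀ i, σ i ^ 2 = q i) (hinj : Function.Injective q) (hmod : ∀ i, q i % 4 = 1)
    (hprime : ∀ i, (q i).natAbs.Prime) (f : Fin n → Fin 2 → ℂ)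
    (hf : ∀ i, f i = ![1, (1 + σ i) / 2] ∨ f i = ![(1 + σ i) / 2, (1 - σ i) / 2]) :
    (∀ p : ℕ, p.Prime → p ≠ 2 → (∀ i, (q i).natAbs ≠ p) →
      ReducedMod (IntermediateField.adjoin ℚ (Set.range σ ∪ {Complex.I})) p) ∧
    IsIntBasis (IntermediateField.adjoin ℚ (Set.range σ ∪ {Complex.I}))
      fun t : Fin (n + 1) → Fin 2 =>
        (∏ i, f i (t i.castSucc)) * Complex.I ^ (t (Fin.last n) : ℕ) := by
  induction n with
  | zero =>
    have hr : Set.range σ ∪ {Complex.I} = {Complex.I} := by simp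
    rw [hr]
    refine ⟨fun p hp h2 _ => isQuadExt_I.reducedMod hp ?_ ?_ (reducedMod_bot hp), ?_⟩
    · exact isCoprime_of_prime_ne (by norm_num) hp (by simpa using h2.symm)
    · exact isCoprime_one_left.neg_left
    · simpa using isIntBasis_adjoin_I
  | succ n ih =>
    obtain ⟨ihR, ihB⟩ := ih (Fin.tail q) (Fin.tail σ) (fun i => hσ _)
      (hinj.comp (Fin.succ_injective n)) (fun i => hmod _) (fun i => hprime _) (Fin.tail f)
      (fun i => hf _)
    have hodd : (q 0).natAbs ≠ 2 := by have := hmod 0; omega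
    have hred := ihR _ (hprime 0) hodd fun i hi => by
      have h1 := hmod i.succ
      have h0 := hmod 0
      have : q i.succ = q 0 := by
        simp only [Fin.tail] at hi
        omega
      exact Fin.succ_ne_zero i (hinj this)
    have h := isQuadExt_adjoin_insert (hσ 0) (hred.notMem (hσ 0) (hprime 0))
    rw [range_union_eq_insert]
    refine ⟨fun p hp h2 hne => h.reducedMod hp ?_ (isCoprime_of_prime_ne (hprime 0) hp (hne 0))
      (ihR p hp h2 fun i => hne _), ?_⟩
    · exact isCoprime_of_prime_ne (by norm_num) hp (by simpa using h2.symm)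
    have hα := isIntegral_half_one_add (hσ 0) (hmod 0)
    have hα' : IsIntegral ℤ ((1 - σ 0) / 2) := by
      refine .of_eq (isIntegral_one.sub hα) ?_; ring
    have h2m : (2 : ℂ) ∈ IntermediateField.adjoin ℚ
        (insert (σ 0) (Set.range (Fin.tail σ) ∪ {Complex.I})) := ofNat_mem _ 2
    have hαm := div_mem (add_mem (one_mem _) h.mem) h2m
    have hαm' := div_mem (sub_mem (one_mem _) h.mem) h2m
    have := ihB.mul h.le (f := f 0) ?_ ?_ ?_ ?_
    · convert this using 2 with t
      rw [Fin.prod_univ_succ, mul_assoc]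
      rfl
    · rcases hf 0 with hf | hf <;> rw [hf, Fin.forall_fin_two]
      · exact ⟨one_mem _, hαm⟩
      · exact ⟨hαm, hαm'⟩
    · rcases hf 0 with hf | hf <;> rw [hf, Fin.forall_fin_two]
      · exact ⟨isIntegral_one, hα⟩
      · exact ⟨hα, hα'⟩
    · intro u hu v hv h0
      have h2K := ofNat_mem (IntermediateField.adjoin ℚ (Set.range (Fin.tail σ) ∪ {Complex.I})) 2
      rcases hf 0 with hf | hf <;> simp only [hf, Matrix.cons_val_zero, Matrix.cons_val_one] at h0
      · obtain ⟨h1, h3⟩ := h.eq_zero_of_add_mul_eq_zero (u := u + v / 2) (v := v / 2)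
          (add_mem hu (div_mem hv h2K)) (div_mem hv h2K) (by linear_combination h0)
        exact ⟨by linear_combination h1 - h3, by linear_combination 2 * h3⟩
      · obtain ⟨h1, h3⟩ := h.eq_zero_of_add_mul_eq_zero (u := u + v) (v := u - v)
          (add_mem hu hv) (sub_mem hu hv) (by linear_combination 2 * h0)
        exact ⟨by linear_combination (h1 + h3) / 2, by linear_combination (h1 - h3) / 2⟩
    · intro x hx hi
      obtain ⟨u, hu, v, hv, hui, hvi, rfl⟩ :=
        h.exists_eq_add_mul_half (hprime 0) (hmod 0) hred hx hi
      rcases hf 0 with hf | hf <;> simp only [hf, Matrix.cons_val_zero, Matrix.cons_val_one]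
      · exact ⟨u, hu, v, hv, hui, hvi, by ring⟩
      · exact ⟨u + v, add_mem hu hv, u, hu, hui.add hvi, hui, by ring⟩

/- Here `r = r' + 1`: the indices `1, …, r−1` correspond to `i.castSucc` for
`i : Fin r'`, the index `r` corresponds to `Fin.last r'`, and `q̃_r = −4`,
`α_r = √(−4/4) = i`. -/
theorem stmt7 (r' : ℕ) (qt : Fin (r' + 1) → ℤ)
    (hinj : Function.Injective fun i : Fin r' => qt i.castSucc)
    (hmod : ∀ i : Fin r', qt i.castSucc % 4 = 1)
    (hoddprime : ∀ i : Fin r', Odd (qt i.castSucc).natAbs ∧ (qt i.castSucc).natAbs.Prime)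
    (hlast : qt (Fin.last r') = -4)
    (a : Fin (r' + 1) → ℂ) (abar : Fin r' → ℂ)
    (ha : ∀ i : Fin r', a i.castSucc = (1 + csqrt (qt i.castSucc : ℝ)) / 2)
    (habar : ∀ i : Fin r', abar i = (1 - csqrt (qt i.castSucc : ℝ)) / 2)
    (halast : a (Fin.last r') = Complex.I)
    -- `M = ℚ(√q̃_1, …, √q̃_{r−1}, i)` generated inside `ℂ`
    (M : IntermediateField ℚ ℂ)
    (hM : M = IntermediateField.adjoin ℚ
      ((Set.range fun i : Fin r' => csqrt (qt i.castSucc : ℝ)) ∪ {Complex.I}))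
    (e e' : (Fin (r' + 1) → Fin 2) → ℂ)
    (he : ∀ s, e s = ∏ i, a i ^ (s i : ℕ))
    (he' : ∀ s, e' s =
      (∏ i : Fin r', abar i ^ (s i.castSucc : ℕ) * a i.castSucc ^ (1 - (s i.castSucc : ℕ))) *
        a (Fin.last r') ^ (s (Fin.last r') : ℕ)) :
    IsIntBasis M e ∧ IsIntBasis M e' := by
  subst hM
  have key := fun f hf => (reducedMod_and_isIntBasis r' (fun i => qt i.castSucc)
    (fun i => csqrt (qt i.castSucc : ℝ)) (fun i => csqrt_intCast_sq _) hinj hmod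
    (fun i => (hoddprime i).2) f hf).2
  constructor
  · convert key (fun i => ![1, (1 + csqrt (qt i.castSucc : ℝ)) / 2]) (fun i => Or.inl rfl)
      using 1
    funext s
    rw [he, Fin.prod_univ_castSucc, halast]
    congr 1
    refine Finset.prod_congr rfl fun i _ => ?_
    rw [ha]
    generalize s i.castSucc = j
    fin_cases j <;> simp
  · convert key (fun i => ![(1 + csqrt (qt i.castSucc : ℝ)) / 2,
      (1 - csqrt (qt i.castSucc : ℝ)) / 2]) (fun i => Or.inr rfl) using 1
    funext s
    rw [he', halast]
    congr 1
    refine Finset.prod_congr rfl fun i _ => ?_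
    rw [ha, habar]
    generalize s i.castSucc = j
    fin_cases j <;> simp
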